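/- Under the attacked-network setup, let i, i′ be two neuron indices with b_i < b_{i′}, and assume the inputs {x_j : j ∈ A_{i′} \ A_i} are linearly independent and r_j ≠ 0 for every j ∈ A_{i′} \ A_i. Then the slice vector (1/g_{i′}) · ∇_{W_{i′}} L − (1/g_i) · ∇_{W_i} L equals the zero vector if and only if the slice is empty, i.e., A_{i′} \ A_i = ∅. -/

import Mathlib

open scoped RealInnerProductSpace BigOperators

noncomputable section

/-- Output of the attacked network: `F(W, b; x) = ∑ i, g i * max (⟪W i, x⟫ + b i) 0 + c`. -/
def netF {d N : ℕ} (g : Fin N → ℝ) (c : ℝ)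
    (W : Fin N → EuclideanSpace ℝ (Fin d)) (b : Fin N → ℝ)
    (x : EuclideanSpace ℝ (Fin d)) : ℝ :=
  (∑ i, g i * max (⟪W i, x⟫ + b i) 0) + c

/-- Batch loss `L(W, b) = (1/B) ∑ j, ℓ j (F(W, b; x j))`. -/
def batchLoss {d B N : ℕ} (ℓ : Fin B → ℝ → ℝ) (g : Fin N → ℝ) (c : ℝ)
    (x : Fin B → EuclideanSpace ℝ (Fin d))
    (W : Fin N → EuclideanSpace ℝ (Fin d)) (b : Fin N → ℝ) : ℝ :=
  (1 / (B : ℝ)) * ∑ j, ℓ j (netF g c W b (x j))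

/-- Residual `r j = ℓ j ′ (F(w, b; x j))`, at the point where all weight rows equal `w`. -/
def sResidual {d B N : ℕ} (ℓ : Fin B → ℝ → ℝ) (g : Fin N → ℝ) (c : ℝ)
    (x : Fin B → EuclideanSpace ℝ (Fin d)) (w : EuclideanSpace ℝ (Fin d))
    (b : Fin N → ℝ) (j : Fin B) : ℝ :=
  deriv (ℓ j) (netF g c (fun _ => w) b (x j))

/-- Active set `A i = {j : ⟪w, x j⟫ + b i > 0}`. -/
def activeSet {d B N : ℕ} (x : Fin B → EuclideanSpace ℝ (Fin d))
    (w : EuclideanSpace ℝ (Fin d)) (b : Fin N → ℝ) (i : Fin N) : Finset (Fin B) :=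
  Finset.univ.filter fun j => 0 < ⟪w, x j⟫ + b i

/-- Gradient of the batch loss with respect to the `i`-th weight row, at the evaluation
point where all weight rows equal `w`. -/
def gradW {d B N : ℕ} (ℓ : Fin B → ℝ → ℝ) (g : Fin N → ℝ) (c : ℝ)
    (x : Fin B → EuclideanSpace ℝ (Fin d)) (w : EuclideanSpace ℝ (Fin d))
    (b : Fin N → ℝ) (i : Fin N) : EuclideanSpace ℝ (Fin d) :=
  gradient (fun Wi : EuclideanSpace ℝ (Fin d) =>
    batchLoss ℓ g c x (Function.update (fun _ => w) i Wi) b) w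

/-- Partial derivative of the batch loss with respect to the `i`-th bias, at the evaluation
point where all weight rows equal `w`. -/
def gradB {d B N : ℕ} (ℓ : Fin B → ℝ → ℝ) (g : Fin N → ℝ) (c : ℝ)
    (x : Fin B → EuclideanSpace ℝ (Fin d)) (w : EuclideanSpace ℝ (Fin d))
    (b : Fin N → ℝ) (i : Fin N) : ℝ :=
  deriv (fun t : ℝ => batchLoss ℓ g c x (fun _ => w) (Function.update b i t)) (b i)


lemma netF_update_eq {d N : ℕ} (g : Fin N → ℝ) (c : ℝ)
    (w : EuclideanSpace ℝ (Fin d)) (b : Fin N → ℝ) (y : EuclideanSpace ℝ (Fin d))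
    (i : Fin N) (v : EuclideanSpace ℝ (Fin d)) :
    netF g c (Function.update (fun _ => w) i v) b y =
      g i * max (⟪v, y⟫ + b i) 0 +
        ((∑ k ∈ Finset.univ.erase i, g k * max (⟪w, y⟫ + b k) 0) + c) := by
  unfold netF
  rw [← Finset.add_sum_erase _ _ (Finset.mem_univ i), Function.update_self, add_assoc]
  congr 2
  apply Finset.sum_congr rfl
  intro k hk
  rw [Function.update_of_ne (Finset.ne_of_mem_erase hk)]

lemma hasFDerivAt_relu {d : ℕ} (w y : EuclideanSpace ℝ (Fin d)) (β : ℝ)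
    (h : ⟪w, y⟫ + β ≠ 0) :
    HasFDerivAt (fun v : EuclideanSpace ℝ (Fin d) => max (⟪v, y⟫ + β) 0)
      ((if 0 < ⟪w, y⟫ + β then (1 : ℝ) else 0) • innerSL ℝ y) w := by
  have hlin : HasFDerivAt (fun v : EuclideanSpace ℝ (Fin d) => ⟪v, y⟫ + β) (innerSL ℝ y) w := by
    have h1 := ((innerSL ℝ y).hasFDerivAt (x := w)).add_const β
    refine h1.congr_of_eventuallyEq (Filter.Eventually.of_forall fun v => ?_)
    simp [real_inner_comm]
  have hc : ContinuousAt (fun v : EuclideanSpace ℝ (Fin d) => ⟪v, y⟫ + β) w := hlin.continuousAt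
  by_cases hp : 0 < ⟪w, y⟫ + β
  · rw [if_pos hp, one_smul]
    refine hlin.congr_of_eventuallyEq ?_
    filter_upwards [hc.eventually (lt_mem_nhds hp)] with v hv
    exact max_eq_left hv.le
  · rw [if_neg hp, zero_smul]
    have hn : ⟪w, y⟫ + β < 0 := lt_of_le_of_ne (not_lt.mp hp) h
    refine (hasFDerivAt_const (0 : ℝ) w).congr_of_eventuallyEq ?_
    filter_upwards [hc.eventually (gt_mem_nhds hn)] with v hv
    exact max_eq_right hv.le

lemma gradW_eq {d B N : ℕ}
    (x : Fin B → EuclideanSpace ℝ (Fin d)) (w : EuclideanSpace ℝ (Fin d))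
    (b : Fin N → ℝ) (g : Fin N → ℝ) (c : ℝ)
    (ℓ : Fin B → ℝ → ℝ) (hℓ : ∀ j, Differentiable ℝ (ℓ j))
    (hboundary : ∀ (i : Fin N) (j : Fin B), ⟪w, x j⟫ + b i ≠ 0) (i : Fin N) :
    gradW ℓ g c x w b i = g i • (1 / (B : ℝ)) •
      ∑ j ∈ activeSet x w b i, sResidual ℓ g c x w b j • x j := by
  unfold gradW
  apply HasGradientAt.gradient
  rw [hasGradientAt_iff_hasFDerivAt]
  have hj : ∀ j : Fin B, HasFDerivAt (fun v : EuclideanSpace ℝ (Fin d) =>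
      ℓ j (netF g c (Function.update (fun _ => w) i v) b (x j)))
      (sResidual ℓ g c x w b j • g i •
        ((if 0 < ⟪w, x j⟫ + b i then (1 : ℝ) else 0) • innerSL ℝ (x j))) w := by
    intro j
    have h1 : HasFDerivAt (fun v : EuclideanSpace ℝ (Fin d) =>
        netF g c (Function.update (fun _ => w) i v) b (x j))
        (g i • ((if 0 < ⟪w, x j⟫ + b i then (1 : ℝ) else 0) • innerSL ℝ (x j))) w := by
      simp only [netF_update_eq]
      exact ((hasFDerivAt_relu w (x j) (b i) (hboundary i j)).const_mul (g i)).add_const _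
    have h2 : HasDerivAt (ℓ j) (sResidual ℓ g c x w b j)
        (netF g c (Function.update (fun _ => w) i w) b (x j)) := by
      have : Function.update (fun _ : Fin N => w) i w = fun _ => w :=
        Function.update_eq_self i (fun _ : Fin N => w)
      rw [this]
      exact (hℓ j _).hasDerivAt
    exact h2.comp_hasFDerivAt w h1
  have hsum := (HasFDerivAt.fun_sum (u := Finset.univ) fun j _ => hj j).const_mul (1 / (B : ℝ))
  unfold batchLoss
  refine hsum.congr_fderiv ?_
  ext v
  simp only [activeSet, Finset.sum_filter, InnerProductSpace.toDual_apply_apply, inner_smul_left,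
    sum_inner, ContinuousLinearMap.smul_apply, ContinuousLinearMap.sum_apply, innerSL_apply_apply,
    smul_eq_mul, conj_trivial, Finset.mul_sum]
  apply Finset.sum_congr rfl
  intro j _
  split_ifs
  · rw [inner_smul_left]; simp only [conj_trivial]; ring
  · simp

/-- if the inputs in the slice `A i' \ A i` are linearly independent and have
nonzero residuals, then the slice vector vanishes if and only if the slice is empty. -/
theorem slice_vector_zero_iff_empty
    {d B N : ℕ}
    (x : Fin B → EuclideanSpace ℝ (Fin d)) (w : EuclideanSpace ℝ (Fin d))
    (b : Fin N → ℝ) (g : Fin N → ℝ) (c : ℝ)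
    (hg : ∀ i, g i ≠ 0)
    (ℓ : Fin B → ℝ → ℝ) (hℓ : ∀ j, Differentiable ℝ (ℓ j))
    (hboundary : ∀ (i : Fin N) (j : Fin B), ⟪w, x j⟫ + b i ≠ 0)
    (i i' : Fin N) (hbb : b i < b i')
    (hind : LinearIndependent ℝ
      (fun j : {j // j ∈ activeSet x w b i' \ activeSet x w b i} => x j.val))
    (hr : ∀ j ∈ activeSet x w b i' \ activeSet x w b i, sResidual ℓ g c x w b j ≠ 0) :
    (g i')⁻¹ • gradW ℓ g c x w b i' - (g i)⁻¹ • gradW ℓ g c x w b i = 0 ↔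
      activeSet x w b i' \ activeSet x w b i = ∅ := by
  have hsub : activeSet x w b i ⊆ activeSet x w b i' := by
    intro j
    simp only [activeSet, Finset.mem_filter, Finset.mem_univ, true_and]
    intro h
    linarith
  rw [gradW_eq x w b g c ℓ hℓ hboundary, gradW_eq x w b g c ℓ hℓ hboundary,
    inv_smul_smul₀ (hg i'), inv_smul_smul₀ (hg i), ← smul_sub,
    ← Finset.sum_sdiff hsub, add_sub_cancel_right]
  constructor
  · intro h
    by_contra hne
    obtain ⟨j, hj⟩ := Finset.nonempty_iff_ne_empty.mpr hne
    have hB : (1 / (B : ℝ)) ≠ 0 := by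
      have : 0 < B := j.pos
      positivity
    have h0 := (smul_eq_zero.mp h).resolve_left hB
    rw [← Finset.sum_coe_sort] at h0
    exact hr j hj (Fintype.linearIndependent_iff.mp hind
      (fun j => sResidual ℓ g c x w b j.val) h0 ⟨j, hj⟩)
  · intro h
    rw [h]
    simp

end
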